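/- arXiv:2003.10148 — 2 statements merged into one kernel-verified Lean document; each statement's English description precedes it below -/
import Mathlib

section
/- Let R be a unital associative ℂ-algebra, M a left R-module, N ⊆ M an R-submodule, and f ∈ R such that: (i) δ_f is locally nilpotent on R (δ_f(b) = f*b − b*f, every a ∈ R killed by some iterate of δ_f); (ii) the action of f on M is bijective with inverse F : M → M; (iii) for every v ∈ M there exists r ∈ ℕ with f^r • v ∈ N. Fix x ∈ ℂ and define a ∗_x v := Σ_{j≥0} binom(x,j) (δ_f^j(a)) • F^j(v). Then for every a ∈ R: a • n = 0 for all n ∈ N if and only if a ∗_x v = 0 for all v ∈ M; that is, the annihilator of the submodule N in R equals the annihilator of the x-twisted module M in R. -/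
noncomputable section

/-- The inner derivation `δ_f b = f*b - b*f`. -/
def innerDeriv {R : Type*} [Ring R] (f : R) : R → R := fun b => f * b - b * f

/-- The generalised binomial coefficient `binom(x, j) = x(x-1)⋯(x-j+1)/j!` for `x : ℂ`. -/
def cchoose (x : ℂ) (j : ℕ) : ℂ :=
  (∏ i ∈ Finset.range j, (x - i)) / (j.factorial : ℂ)

/-- Mathieu's `x`-twisted action of `a : R` on `v : M`:
`a ∗ₓ v = ∑_{j ≥ 0} binom(x, j) • (δ_f^[j] a) • F^[j] v`, a finite sum when `δ_f` is
locally nilpotent, where `F` is the inverse of the (bijective) action of `f` on `M`. -/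
def twistedSMul {R M : Type*} [Ring R] [Algebra ℂ R] [AddCommGroup M] [Module R M]
    (f : R) (F : M → M) (x : ℂ) (a : R) (v : M) : M :=
  ∑ᶠ j : ℕ, (algebraMap ℂ R (cchoose x j) * (innerDeriv f)^[j] a) • F^[j] v

section TwistedAction

variable {R M : Type*} [Ring R] [AddCommGroup M] [Module R M] {f : R} {F : M → M}

theorem innerDeriv_iterate_zero_right (f : R) (n : ℕ) : (innerDeriv f)^[n] 0 = 0 :=
  Function.iterate_fixed (by simp [innerDeriv]) n

theorem innerDeriv_smul_eq_zero {N : Submodule R M} {a : R} (h : ∀ n ∈ N, a • n = 0) :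
    ∀ n ∈ N, innerDeriv f a • n = 0 := by
  intro n hn
  simp [innerDeriv, sub_smul, mul_smul, h n hn, h _ (N.smul_mem f hn)]

theorem innerDeriv_iterate_smul_eq_zero {N : Submodule R M} {a : R} (h : ∀ n ∈ N, a • n = 0)
    (k : ℕ) : ∀ n ∈ N, (innerDeriv f)^[k] a • n = 0 := by
  induction k generalizing a with
  | zero => exact h
  | succ k ih => exact ih (innerDeriv_smul_eq_zero h)

/-- If `δ_f` is nilpotent on `a`, `f` acts injectively and every vector is carried into `N` by a
power of `f`, then `a` annihilates `M` as soon as it annihilates `N`. -/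
theorem smul_eq_zero_of_smul_submodule_eq_zero {N : Submodule R M}
    (hf : Function.Injective fun v : M => f • v) (hsat : ∀ v : M, ∃ r : ℕ, f ^ r • v ∈ N)
    {a : R} {k : ℕ} (hk : (innerDeriv f)^[k] a = 0) (h : ∀ n ∈ N, a • n = 0) (v : M) :
    a • v = 0 := by
  induction k generalizing a v with
  | zero =>
    have ha : a = 0 := hk
    simp [ha]
  | succ k ih =>
    have hcomm (w : M) : f • a • w = a • f • w := by
      have := ih hk (innerDeriv_smul_eq_zero h) w
      simpa [innerDeriv, sub_smul, mul_smul, sub_eq_zero] using this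
    have key (r : ℕ) (w : M) (hw : f ^ r • w ∈ N) : a • w = 0 := by
      induction r generalizing w with
      | zero => exact h w (by simpa using hw)
      | succ r ihr =>
        apply hf
        simpa [hcomm] using ihr (f • w) (by simpa [pow_succ, mul_smul] using hw)
    obtain ⟨r, hr⟩ := hsat v
    exact key r v hr

variable [Algebra ℂ R]

theorem twistedSMul_eq_sum_range (x : ℂ) {a : R} {k : ℕ} (hk : (innerDeriv f)^[k] a = 0) (v : M) :
    twistedSMul f F x a v = ∑ j ∈ Finset.range k,
      (algebraMap ℂ R (cchoose x j) * (innerDeriv f)^[j] a) • F^[j] v := by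
  refine finsum_eq_sum_of_support_subset _ fun j hj => ?_
  by_contra hjk
  have hkj : k ≤ j := by simpa using hjk
  apply hj
  obtain ⟨d, rfl⟩ := Nat.exists_eq_add_of_le' hkj
  simp [Function.iterate_add_apply, hk, innerDeriv_iterate_zero_right]

/-- The twisted action intertwines `δ_f` with the commutator by `f`. -/
theorem twistedSMul_innerDeriv (hcomm : Function.Commute F fun v : M => f • v) (x : ℂ) {a : R}
    {k : ℕ} (hk : (innerDeriv f)^[k] a = 0) (v : M) :
    twistedSMul f F x (innerDeriv f a) v =
      f • twistedSMul f F x a v - twistedSMul f F x a (f • v) := by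
  have hk' : (innerDeriv f)^[k] (innerDeriv f a) = 0 := by
    rw [← Function.iterate_succ_apply, Function.iterate_succ_apply', hk]
    simp [innerDeriv]
  rw [twistedSMul_eq_sum_range x hk', twistedSMul_eq_sum_range x hk,
    twistedSMul_eq_sum_range x hk, Finset.smul_sum, ← Finset.sum_sub_distrib]
  refine Finset.sum_congr rfl fun j _ => ?_
  have hF : F^[j] (f • v) = f • F^[j] v := hcomm.iterate_left j v
  rw [hF, ← Function.iterate_succ_apply, Function.iterate_succ_apply', smul_smul, smul_smul,
    ← sub_smul, innerDeriv, mul_sub, ← mul_assoc f, ← Algebra.commutes (cchoose x j) f]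
  simp only [mul_assoc]

theorem smul_eq_zero_of_twistedSMul_eq_zero (hcomm : Function.Commute F fun v : M => f • v)
    (x : ℂ) {a : R} {k : ℕ} (hk : (innerDeriv f)^[k] a = 0)
    (h : ∀ v : M, twistedSMul f F x a v = 0) (v : M) : a • v = 0 := by
  induction k generalizing a v with
  | zero =>
    have ha : a = 0 := hk
    simp [ha]
  | succ k ih =>
    have hd (w : M) : innerDeriv f a • w = 0 :=
      ih hk (fun u => by simp [twistedSMul_innerDeriv hcomm x hk, h]) w
    have hj (j : ℕ) (w : M) : (innerDeriv f)^[j + 1] a • w = 0 :=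
      innerDeriv_iterate_smul_eq_zero (N := ⊤) (fun n _ => hd n) j w trivial
    have hv := h v
    rw [twistedSMul_eq_sum_range x hk, Finset.sum_range_succ'] at hv
    simpa [mul_smul, hj, cchoose, -Function.iterate_succ] using hv

end TwistedAction

/-- Let `N ⊆ M` be an `R`-submodule; assume `δ_f` is locally nilpotent,
the `f`-action on `M` is bijective with inverse `F`, and every `v ∈ M` is carried into `N`
by some power of `f`.  Then `a` annihilates `N` iff `a` annihilates the `x`-twisted
module `M`. -/
theorem annihilator_submodule_eq_annihilator_twisted {R M : Type*} [Ring R] [Algebra ℂ R]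
    [AddCommGroup M] [Module R M] (N : Submodule R M) (f : R) (F : M → M)
    (hnil : ∀ a : R, ∃ n : ℕ, (innerDeriv f)^[n] a = 0)
    (hFl : ∀ v : M, F (f • v) = v) (hFr : ∀ v : M, f • F v = v)
    (hsat : ∀ v : M, ∃ r : ℕ, f ^ r • v ∈ N)
    (x : ℂ) (a : R) :
    (∀ n ∈ N, a • n = 0) ↔ ∀ v : M, twistedSMul f F x a v = 0 := by
  have hf : Function.Injective fun v : M => f • v := Function.LeftInverse.injective hFl
  have hcomm : Function.Commute F fun v : M => f • v := fun v => (hFl v).trans (hFr v).symm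
  obtain ⟨k, hk⟩ := hnil a
  constructor
  · intro h v
    have hM (w : M) : a • w = 0 := smul_eq_zero_of_smul_submodule_eq_zero hf hsat hk h w
    rw [twistedSMul_eq_sum_range x hk]
    refine Finset.sum_eq_zero fun j _ => ?_
    rw [mul_smul, innerDeriv_iterate_smul_eq_zero (N := ⊤) (fun n _ => hM n) j _ trivial, smul_zero]
  · exact fun h n _ => smul_eq_zero_of_twistedSMul_eq_zero hcomm x hk h n
end
end

section
/- Let R be a unital associative ℂ-algebra, M a left R-module, and f ∈ R such that δ_f is locally nilpotent on R (δ_f(b) = f*b − b*f) and the action of f on M is bijective with inverse F : M → M. Fix x ∈ ℂ and define a ∗_x v := Σ_{j≥0} binom(x,j) (δ_f^j(a)) • F^j(v). Then ∗_x defines a left R-module structure on the additive group M: it is additive in a and in v, satisfies 1 ∗_x v = v, and (a*b) ∗_x v = a ∗_x (b ∗_x v) for all a, b ∈ R and v ∈ M. -/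
noncomputable section

open Polynomial in
lemma exists_polynomial_eval_eq_cchoose (j : ℕ) : ∃ p : ℂ[X], ∀ x : ℂ, p.eval x = cchoose x j :=
  ⟨C (j.factorial : ℂ)⁻¹ * descPochhammer ℂ j, fun x => by
    rw [eval_mul, eval_C, descPochhammer_eval_eq_prod_range, cchoose, div_eq_inv_mul]⟩

lemma cchoose_natCast (n j : ℕ) : cchoose n j = n.choose j := by
  rw [cchoose, ← descPochhammer_eval_eq_prod_range, descPochhammer_eval_eq_descFactorial,
    Nat.descFactorial_eq_factorial_mul_choose, Nat.cast_mul,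
    mul_div_cancel_left₀ _ (Nat.cast_ne_zero.2 j.factorial_ne_zero)]

lemma cchoose_zero_right (x : ℂ) : cchoose x 0 = 1 := by
  simp [cchoose]

open Polynomial in
/-- A vector-valued polynomial function over `ℂ` that vanishes at all natural numbers is zero. -/
lemma sum_eval_smul_eq_zero_of_natCast {M ι : Type*} [AddCommGroup M] [Module ℂ M]
    (s : Finset ι) (p : ι → ℂ[X]) (m : ι → M)
    (h : ∀ n : ℕ, ∑ i ∈ s, (p i).eval (n : ℂ) • m i = 0) (x : ℂ) :
    ∑ i ∈ s, (p i).eval x • m i = 0 := by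
  rw [← Module.forall_dual_apply_eq_zero_iff ℂ]
  intro φ
  have hq (y : ℂ) : (∑ i ∈ s, p i * C (φ (m i))).eval y = φ (∑ i ∈ s, (p i).eval y • m i) := by
    simp [eval_finsetSum]
  have hzero : ∑ i ∈ s, p i * C (φ (m i)) = 0 := by
    refine eq_zero_of_infinite_isRoot _ ((Set.infinite_range_of_injective
      (Nat.cast_injective (R := ℂ))).mono ?_)
    rintro _ ⟨n, rfl⟩
    rw [Set.mem_ofPred_eq, IsRoot, hq, h, map_zero]
  rw [← hq, hzero, eval_zero]

section InnerDeriv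

variable {R : Type*} [Ring R] [Algebra ℂ R]

lemma innerDeriv_iterate (f : R) (j : ℕ) :
    (innerDeriv f)^[j] = ⇑((LinearMap.mulLeft ℂ f - LinearMap.mulRight ℂ f) ^ j) := by
  rw [Module.End.coe_pow]
  rfl

lemma innerDeriv_iterate_eq_zero_of_le {f a : R} {m n : ℕ} (hmn : m ≤ n)
    (h : (innerDeriv f)^[m] a = 0) : (innerDeriv f)^[n] a = 0 := by
  obtain ⟨k, rfl⟩ := Nat.exists_eq_add_of_le' hmn
  rw [Function.iterate_add_apply, h, innerDeriv_iterate, map_zero]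

lemma pow_mul_eq_sum_innerDeriv (f a : R) (n : ℕ) :
    f ^ n * a = ∑ j ∈ Finset.range (n + 1), (n.choose j : ℂ) •
      ((innerDeriv f)^[j] a * f ^ (n - j)) := by
  have hc : Commute (LinearMap.mulLeft ℂ f - LinearMap.mulRight ℂ f) (LinearMap.mulRight ℂ f) :=
    (LinearMap.commute_mulLeft_right f f).sub_left (Commute.refl _)
  have h := congrArg (fun T : Module.End ℂ R => T a) (hc.add_pow n)
  simp only [sub_add_cancel, LinearMap.pow_mulLeft, LinearMap.mulLeft_apply] at h
  rw [h, LinearMap.sum_apply]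
  refine Finset.sum_congr rfl fun j _ => ?_
  rw [innerDeriv_iterate, (hc.pow_pow j (n - j)).eq, LinearMap.pow_mulRight]
  rw [← nsmul_eq_mul', LinearMap.smul_apply, Nat.cast_smul_eq_nsmul]
  rfl

end InnerDeriv

section Twist

variable {R M : Type*} [Ring R] [Algebra ℂ R] [AddCommGroup M] [Module R M]
  [Module ℂ M] [IsScalarTower ℂ R M] {f : R}

lemma twistedSMul_eq_finsum_smul (F : M → M) (x : ℂ) (a : R) (v : M) :
    twistedSMul f F x a v = ∑ᶠ j : ℕ, cchoose x j • (innerDeriv f)^[j] a • F^[j] v := by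
  simp only [twistedSMul, ← Algebra.smul_def, smul_assoc]

lemma twistedSMul_eq_sum (F : M → M) (x : ℂ) {a : R} {N : ℕ}
    (hN : (innerDeriv f)^[N] a = 0) (v : M) :
    twistedSMul f F x a v =
      ∑ j ∈ Finset.range N, cchoose x j • (innerDeriv f)^[j] a • F^[j] v := by
  rw [twistedSMul_eq_finsum_smul]
  refine finsum_eq_sum_of_support_subset _ fun j hj => ?_
  by_contra hjN
  have hle : N ≤ j := by simpa using hjN
  exact hj (by simp [innerDeriv_iterate_eq_zero_of_le hle hN])

/-- For a natural number `n`, the `n`-twisted action is conjugation by `f ^ n`. -/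
lemma twistedSMul_natCast {F : M → M} (hFr : ∀ v : M, f • F v = v) (n : ℕ) (a : R) (v : M) :
    twistedSMul f F n a v = f ^ n • a • F^[n] v := by
  have hpow (k : ℕ) (w : M) : f ^ k • F^[k] w = w := by
    induction k with
    | zero => simp
    | succ k ih => rw [pow_succ, Function.iterate_succ_apply', mul_smul, hFr, ih]
  rw [twistedSMul_eq_finsum_smul, finsum_eq_sum_of_support_subset (s := Finset.range (n + 1)),
    ← mul_smul, pow_mul_eq_sum_innerDeriv, Finset.sum_smul]
  · refine Finset.sum_congr rfl fun j hj => ?_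
    have hjn : j ≤ n := Finset.mem_range_succ_iff.1 hj
    rw [cchoose_natCast, smul_assoc, mul_smul]
    conv_rhs => rw [← Nat.sub_add_cancel hjn, Function.iterate_add_apply, Nat.sub_add_cancel hjn,
      hpow]
  · intro j hj
    by_contra hjn
    have hlt : n < j := by simpa using hjn
    exact hj (by simp [cchoose_natCast, Nat.choose_eq_zero_of_lt hlt])

lemma twistedSMul_natCast_mul {F : M → M} (hFl : ∀ v : M, F (f • v) = v)
    (hFr : ∀ v : M, f • F v = v) (n : ℕ) (a b : R) (v : M) :
    twistedSMul f F n (a * b) v = twistedSMul f F n a (twistedSMul f F n b v) := by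
  have hpow (k : ℕ) (w : M) : F^[k] (f ^ k • w) = w := by
    induction k with
    | zero => simp
    | succ k ih => rw [pow_succ', Function.iterate_succ_apply, mul_smul, hFl, ih]
  simp only [twistedSMul_natCast hFr, hpow, mul_smul]

/-- A two-sided inverse of the action of `f` is `ℂ`-linear. -/
lemma exists_linearMap_coe_eq_of_inverse {F : M → M} (hFl : ∀ v : M, F (f • v) = v)
    (hFr : ∀ v : M, f • F v = v) : ∃ G : Module.End ℂ M, ⇑G = F :=
  ⟨{ toFun := F
     map_add' := fun v w => by
      rw [← hFl (F v + F w), smul_add, hFr, hFr]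
     map_smul' := fun c v => by
      have h : f • c • F v = c • v := by
        rw [← algebraMap_smul R c (F v), ← mul_smul, ← Algebra.commutes, mul_smul, hFr,
          algebraMap_smul]
      rw [← h, hFl, RingHom.id_apply] }, rfl⟩

lemma twistedSMul_add_smul (hnil : ∀ a : R, ∃ n : ℕ, (innerDeriv f)^[n] a = 0)
    (F : M → M) (x : ℂ) (a b : R) (v : M) :
    twistedSMul f F x (a + b) v = twistedSMul f F x a v + twistedSMul f F x b v := by
  obtain ⟨m, hm⟩ := hnil a
  obtain ⟨n, hn⟩ := hnil b
  have ha := innerDeriv_iterate_eq_zero_of_le (le_max_left m n) hm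
  have hb := innerDeriv_iterate_eq_zero_of_le (le_max_right m n) hn
  have hadd (j : ℕ) :
      (innerDeriv f)^[j] (a + b) = (innerDeriv f)^[j] a + (innerDeriv f)^[j] b := by
    rw [innerDeriv_iterate, map_add]
  rw [twistedSMul_eq_sum F x ha, twistedSMul_eq_sum F x hb,
    twistedSMul_eq_sum F x (N := max m n) (by rw [hadd, ha, hb, add_zero]),
    ← Finset.sum_add_distrib]
  simp only [hadd, add_smul, smul_add]

lemma twistedSMul_smul_add (hnil : ∀ a : R, ∃ n : ℕ, (innerDeriv f)^[n] a = 0)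
    (G : Module.End ℂ M) (x : ℂ) (a : R) (v w : M) :
    twistedSMul f G x a (v + w) = twistedSMul f G x a v + twistedSMul f G x a w := by
  obtain ⟨m, hm⟩ := hnil a
  simp only [twistedSMul_eq_sum G x hm, ← Module.End.coe_pow, map_add, smul_add,
    Finset.sum_add_distrib]

lemma twistedSMul_one_smul (F : M → M) (x : ℂ) (v : M) : twistedSMul f F x 1 v = v := by
  have h : (innerDeriv f)^[1] 1 = 0 := by simp [innerDeriv]
  simp [twistedSMul_eq_sum F x h, cchoose_zero_right]

lemma twistedSMul_mul_smul (hnil : ∀ a : R, ∃ n : ℕ, (innerDeriv f)^[n] a = 0)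
    (G : Module.End ℂ M) (hGl : ∀ v : M, G (f • v) = v) (hGr : ∀ v : M, f • G v = v)
    (x : ℂ) (a b : R) (v : M) :
    twistedSMul f G x (a * b) v = twistedSMul f G x a (twistedSMul f G x b v) := by
  obtain ⟨k, hk⟩ := hnil (a * b)
  obtain ⟨m, hm⟩ := hnil a
  obtain ⟨n, hn⟩ := hnil b
  choose p hp using exists_polynomial_eval_eq_cchoose
  let s := (Finset.range k).disjSum (Finset.range m ×ˢ Finset.range n)
  let q : ℕ ⊕ ℕ × ℕ → Polynomial ℂ := Sum.elim p fun i => p i.1 * p i.2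
  let u : ℕ ⊕ ℕ × ℕ → M := Sum.elim (fun j => (innerDeriv f)^[j] (a * b) • (G ^ j) v)
    fun i => -((innerDeriv f)^[i.1] a • (G ^ i.1) ((innerDeriv f)^[i.2] b • (G ^ i.2) v))
  have key (y : ℂ) : ∑ i ∈ s, (q i).eval y • u i =
      twistedSMul f G y (a * b) v - twistedSMul f G y a (twistedSMul f G y b v) := by
    simp only [s, q, u, Finset.sum_disjSum, Sum.elim_inl, Sum.elim_inr, Polynomial.eval_mul, hp,
      smul_neg, Finset.sum_neg_distrib, ← sub_eq_add_neg, twistedSMul_eq_sum G y hk,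
      twistedSMul_eq_sum G y hm, twistedSMul_eq_sum G y hn, ← Module.End.coe_pow, map_sum,
      map_smul, Finset.smul_sum, Finset.sum_product]
    simp only [mul_smul, ← smul_algebra_smul_comm (A := R)]
  refine sub_eq_zero.1 ((key x).symm.trans (sum_eval_smul_eq_zero_of_natCast s q u ?_ x))
  intro n
  rw [key, twistedSMul_natCast_mul hGl hGr, sub_self]

end Twist

/-- The `x`-twisted action `∗ₓ` defines a left `R`-module structure on
the additive group `M`: it is additive in each argument, unital, and multiplicative. -/
theorem twisted_is_module_structure {R M : Type*} [Ring R] [Algebra ℂ R]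
    [AddCommGroup M] [Module R M] (f : R) (F : M → M)
    (hnil : ∀ a : R, ∃ n : ℕ, (innerDeriv f)^[n] a = 0)
    (hFl : ∀ v : M, F (f • v) = v) (hFr : ∀ v : M, f • F v = v)
    (x : ℂ) :
    (∀ (a b : R) (v : M),
        twistedSMul f F x (a + b) v = twistedSMul f F x a v + twistedSMul f F x b v) ∧
    (∀ (a : R) (v w : M),
        twistedSMul f F x a (v + w) = twistedSMul f F x a v + twistedSMul f F x a w) ∧
    (∀ v : M, twistedSMul f F x 1 v = v) ∧
    (∀ (a b : R) (v : M),
        twistedSMul f F x (a * b) v = twistedSMul f F x a (twistedSMul f F x b v)) := by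
  let : Module ℂ M := Module.compHom M (algebraMap ℂ R)
  have : IsScalarTower ℂ R M := ⟨fun c a v => by
    rw [Algebra.smul_def, mul_smul]
    rfl⟩
  obtain ⟨G, rfl⟩ := exists_linearMap_coe_eq_of_inverse hFl hFr
  exact ⟨twistedSMul_add_smul hnil G x, twistedSMul_smul_add hnil G x,
    twistedSMul_one_smul G x, twistedSMul_mul_smul hnil G hFl hFr x⟩
end
end
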